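/- arXiv:2405.20276 — 3 statements merged into one kernel-verified Lean document; each statement's English description precedes it below -/
import Mathlib

section
/- Every infinite sourced Eulerian digraph is transient: if (G,o) is a sourced Eulerian digraph, then the random walk on G visits each vertex at most finitely often almost surely. -/
open MeasureTheory Filter Set
open scoped ENNReal

namespace DF

/-! ### Sequences over a countable state space -/

variable {S : Type}

/-- The number of transitions from `u` to `v` among the first `n` steps of the sequence `x`. -/
noncomputable def transCount (x : ℕ → S) (n : ℕ) (u v : S) : ℕ :=
  Set.ncard {i : ℕ | i < n ∧ x i = u ∧ x (i + 1) = v}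

/-- The equivalence `(x₀,…,xₙ) ≃ (y₀,…,yₙ)` of finite sequences: same initial state and the same
transition counts between every ordered pair of states. -/
def FinEquiv (x y : ℕ → S) (n : ℕ) : Prop :=
  x 0 = y 0 ∧ ∀ u v : S, transCount x n u v = transCount y n u v

/-- The equivalence `x ≃ y` of infinite sequences: they eventually agree and their initial
segments up to that point are `≃`-equivalent. -/
def InfEquiv (x y : ℕ → S) : Prop :=
  ∃ N : ℕ, (∀ n : ℕ, N ≤ n → x n = y n) ∧ FinEquiv x y N

/-- The transition numbers `M(u,v) = #{i ≥ 0 : (xᵢ, xᵢ₊₁) = (u,v)}` of an infinite sequence. -/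
noncomputable def transNum (x : ℕ → S) (u v : S) : ℕ∞ :=
  Set.encard {i : ℕ | x i = u ∧ x (i + 1) = v}

/-- The sigma-algebra on `S^ℕ` generated by the transition numbers. -/
noncomputable def transSigma (S : Type) : MeasurableSpace (ℕ → S) :=
  ⨆ u : S, ⨆ v : S, MeasurableSpace.comap (fun x => transNum x u v) (⊤ : MeasurableSpace ℕ∞)

/-- The tail sigma-algebra `⋂ₙ σ(Xₙ, Xₙ₊₁, …)` on `S^ℕ`. -/
def tailSigma (S : Type) [MeasurableSpace S] : MeasurableSpace (ℕ → S) :=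
  ⨅ n : ℕ, MeasurableSpace.comap (fun (x : ℕ → S) (i : ℕ) => x (i + n))
    (inferInstance : MeasurableSpace (ℕ → S))

/-- A measure on `S^ℕ` is partially exchangeable if any two `≃`-equivalent finite initial
segments have the same probability. -/
def PartiallyExchangeable [MeasurableSpace S] (μ : Measure (ℕ → S)) : Prop :=
  ∀ (n : ℕ) (x y : ℕ → S), FinEquiv x y n →
    μ {ω | ∀ i ≤ n, ω i = x i} = μ {ω | ∀ i ≤ n, ω i = y i}

/-- The set of partially exchangeable probability measures on `S^ℕ`. -/
def PEProb (S : Type) [MeasurableSpace S] : Set (Measure (ℕ → S)) :=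
  {μ | μ Set.univ = 1 ∧ PartiallyExchangeable μ}

/-- `μ` is an extreme point of the convex set of partially exchangeable probability measures. -/
def IsExtremePE [MeasurableSpace S] (μ : Measure (ℕ → S)) : Prop :=
  μ ∈ PEProb S ∧
    ∀ μ₁ ∈ PEProb S, ∀ μ₂ ∈ PEProb S, ∀ t : ℝ≥0∞, 0 < t → t < 1 →
      μ = t • μ₁ + (1 - t) • μ₂ → μ₁ = μ₂

/-! ### Digraphs -/

/-- A digraph on vertex set `V` with edge set `E`: each edge has a tail (`src`) and head (`dst`).
Multiple edges and loops are allowed. -/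
structure DigraphStruct (V E : Type) where
  src : E → V
  dst : E → V

namespace DigraphStruct

variable {V E : Type} (G : DigraphStruct V E)

def outEdges (v : V) : Set E := {e | G.src e = v}

def inEdges (v : V) : Set E := {e | G.dst e = v}

noncomputable def outDeg (v : V) : ℕ := (G.outEdges v).ncard

noncomputable def inDeg (v : V) : ℕ := (G.inEdges v).ncard

def LocallyFinite : Prop := ∀ v : V, (G.outEdges v).Finite ∧ (G.inEdges v).Finite

/-- Adjacency in the underlying undirected graph. -/
def undirAdj (u v : V) : Prop :=
  ∃ e : E, (G.src e = u ∧ G.dst e = v) ∨ (G.src e = v ∧ G.dst e = u)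

/-- `G` is connected as an undirected graph. -/
def Connected : Prop := ∀ u v : V, Relation.ReflTransGen G.undirAdj u v

def dirAdj (u v : V) : Prop := ∃ e : E, G.src e = u ∧ G.dst e = v

/-- One step along an edge of the edge set `B`. -/
def step (B : Set E) (u v : V) : Prop := ∃ e ∈ B, G.src e = u ∧ G.dst e = v

/-- `(G,o)` is an infinite sourced Eulerian digraph (with sink at infinity). -/
structure IsSourcedEulerian (o : V) : Prop where
  infinite : Infinite V
  locFin : G.LocallyFinite
  conn : G.Connected
  balanced : ∀ v : V, v ≠ o → G.inDeg v = G.outDeg v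
  source : G.outDeg o = G.inDeg o + 1

/-- The reversal of `G`: head and tail of every edge are exchanged. -/
def rev : DigraphStruct V E := ⟨G.dst, G.src⟩

/-- One-step transition probability of the random walk on `G`. -/
noncomputable def stepProb (u v : V) : ℝ≥0∞ :=
  ({e : E | G.src e = u ∧ G.dst e = v}.ncard : ℝ≥0∞) / (G.outDeg u : ℝ≥0∞)

open Classical in
/-- `μ` is the law of the random walk on `G` started at `o`, characterised through its cylinder
probabilities. -/
def IsWalkLaw [MeasurableSpace V] (o : V) (μ : Measure (ℕ → V)) : Prop :=
  μ Set.univ = 1 ∧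
    ∀ (n : ℕ) (x : ℕ → V),
      μ {ω | ∀ i ≤ n, ω i = x i} =
        if x 0 = o then ∏ i ∈ Finset.range n, G.stepProb (x i) (x (i + 1)) else 0

/-- `G` is transient: from every starting point, the random walk on `G` visits every vertex at
most finitely often almost surely. -/
def TransientDigraph [MeasurableSpace V] : Prop :=
  ∀ (o : V) (μ : Measure (ℕ → V)),
    G.IsWalkLaw o μ → μ {ω | ∀ v : V, {i : ℕ | ω i = v}.Finite} = 1

/-- An infinite path in `G` indexed by `ℕ`, encoded by its sequence of edges. -/
def IsInfPath (γ : ℕ → E) : Prop := ∀ i : ℕ, G.dst (γ i) = G.src (γ (i + 1))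

/-- A transient path: it visits every vertex at most finitely often. -/
def IsTransientPath (γ : ℕ → E) : Prop := ∀ v : V, {i : ℕ | G.src (γ i) = v}.Finite

/-- The edge set of the last-exit arboretum `𝓛(γ)`: the edges crossed by `γ` as it exits their
tail for the last time. -/
def lastExitSet (γ : ℕ → E) : Set E :=
  {e | ∃ i : ℕ, γ i = e ∧ ∀ j : ℕ, i < j → G.src (γ j) ≠ G.src (γ i)}

end DigraphStruct

/-! ### Finite paths, Eulerian paths, arborescences -/

/-- `IsPathList G o z P` means that the list of edges `P` forms a directed path from `o`
to `z` in `G`. -/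
def IsPathList {V E : Type} (G : DigraphStruct V E) : V → V → List E → Prop
  | o, z, [] => o = z
  | o, z, e :: es => G.src e = o ∧ IsPathList G (G.dst e) z es

/-- `P` is an Eulerian path from `o` to `z`: a path crossing every edge exactly once. -/
def IsEulerList {V E : Type} (G : DigraphStruct V E) (o z : V) (P : List E) : Prop :=
  IsPathList G o z P ∧ P.Nodup ∧ ∀ e : E, e ∈ P

/-- `B` is (the edge set of) a spanning in-arborescence of `G` rooted at `z`. -/
def IsFinArb {V E : Type} (G : DigraphStruct V E) (z : V) (B : Set E) : Prop :=
  (∀ e ∈ B, G.src e ≠ z) ∧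
  (∀ v : V, v ≠ z → ∃! e : E, e ∈ B ∧ G.src e = v) ∧
  (∀ v : V, Relation.ReflTransGen (G.step B) v z)

/-- `(G,o,z)` is a finite Eulerian digraph with source `o` and sink `z`. -/
structure IsFinEulerian {V E : Type} (G : DigraphStruct V E) (o z : V) : Prop where
  finV : Finite V
  finE : Finite E
  reach_from : ∀ v : V, Relation.ReflTransGen G.dirAdj o v
  reach_to : ∀ v : V, Relation.ReflTransGen G.dirAdj v z
  bal_ne : o ≠ z → (∀ v : V, v ≠ o → v ≠ z → G.inDeg v = G.outDeg v) ∧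
      G.outDeg o = G.inDeg o + 1 ∧ G.inDeg z = G.outDeg z + 1
  bal_eq : o = z → ∀ v : V, G.inDeg v = G.outDeg v

/-! ### Wired uniform spanning in-arborescences -/

/-- An exhaustion of the vertex set by finite subsets. -/
def IsExhaustion {V : Type} (Vn : ℕ → Set V) : Prop :=
  (∀ n, (Vn n).Finite) ∧ (∀ n, Vn n ⊆ Vn (n + 1)) ∧ (⋃ n, Vn n) = Set.univ

/-- `B` is (the edge set of) a spanning in-arborescence of the wired graph `G_U^*`
(all vertices outside `U` identified to a single boundary vertex) rooted at the boundary. -/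
def IsWiredArb {V E : Type} (G : DigraphStruct V E) (U : Set V) (B : Set E) : Prop :=
  (∀ e ∈ B, G.src e ∈ U) ∧ (∀ v ∈ U, ∃! e : E, e ∈ B ∧ G.src e = v) ∧
  (∀ v ∈ U, ∃ v' : V, v' ∉ U ∧ Relation.ReflTransGen (G.step B) v v')

/-- The probability, under the uniform spanning in-arborescence of the wired graph `G_U^*`
rooted at the boundary, that all edges of `F` are present. -/
noncomputable def wiredUACyl {V E : Type} (G : DigraphStruct V E) (U : Set V) (F : Finset E) :
    ℝ≥0∞ :=
  (Nat.card {B : Set E // IsWiredArb G U B ∧ (F : Set E) ⊆ B} : ℝ≥0∞) /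
    (Nat.card {B : Set E // IsWiredArb G U B} : ℝ≥0∞)

/-- `κ` is the law of the wired uniform spanning in-arboretum of `G` (as a random edge set,
encoded as an element of `E → Bool`): its cylinder probabilities are the limits along any
exhaustion of the uniform spanning in-arborescence measures of the wired graphs. -/
def IsWUALaw {V E : Type} (G : DigraphStruct V E) (κ : Measure (E → Bool)) : Prop :=
  κ Set.univ = 1 ∧
    ∀ Vn : ℕ → Set V, IsExhaustion Vn → ∀ F : Finset E,
      Filter.Tendsto (fun n => wiredUACyl G (Vn n) F) Filter.atTop
        (nhds (κ {A | ∀ e ∈ F, A e = true}))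

/-- A spanning in-arboretum rooted at infinity all of whose components are one-ended:
every vertex has out-degree exactly one, and the past of every vertex is finite. -/
def IsOneEndedSpanningArb {V E : Type} (G : DigraphStruct V E) (A : Set E) : Prop :=
  (∀ v : V, ∃! e : E, e ∈ A ∧ G.src e = v) ∧
    ∀ v : V, {u : V | Relation.ReflTransGen (G.step A) u v}.Finite

/-! ### Proper Gibbs measures on Eulerian paths -/

/-- `w` is a finite path in `G` starting at `o` (encoded by its edges). -/
def PrefixPath {V E : Type} (G : DigraphStruct V E) (o : V) {n : ℕ} (w : Fin n → E) : Prop :=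
  (∀ h : 0 < n, G.src (w ⟨0, h⟩) = o) ∧
    ∀ (i : ℕ) (h : i + 1 < n), G.dst (w ⟨i, Nat.lt_of_succ_lt h⟩) = G.src (w ⟨i + 1, h⟩)

/-- A proper Gibbs measure on Eulerian paths from `o` to `∞` in `G`: a probability measure on
edge sequences, supported on half-infinite paths started at `o` crossing every edge exactly once,
such that conditionally on the steps after time `n` the first `n` steps are a uniform Eulerian
path (from `o`, in the digraph spanned by the edges not crossed after time `n`, to the position
at time `n`). Uniformity is expressed by invariance under replacing the first `n` steps by any
other path from `o` crossing the same set of edges. -/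
def ProperGibbs {V E : Type} [MeasurableSpace E] (G : DigraphStruct V E) (o : V)
    (μ : Measure (ℕ → E)) : Prop :=
  μ Set.univ = 1 ∧
  μ {γ | (∀ i : ℕ, G.dst (γ i) = G.src (γ (i + 1))) ∧ G.src (γ 0) = o ∧ Function.Bijective γ}
      = 1 ∧
  ∀ (n : ℕ) (w w' : Fin n → E), Function.Injective w → Function.Injective w' →
    Set.range w = Set.range w' → PrefixPath G o w → PrefixPath G o w' →
    ∀ B : Set (ℕ → E),
      μ {γ | (∀ i : Fin n, γ (i : ℕ) = w i) ∧ (fun t : ℕ => γ (n + t)) ∈ B} =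
        μ {γ | (∀ i : Fin n, γ (i : ℕ) = w' i) ∧ (fun t : ℕ => γ (n + t)) ∈ B}

/-! ### Loop erasure and Wilson's algorithm rooted at infinity -/

/-- The loop-erasure times of the (transient) vertex sequence `p`:
`t₀ = 0`, `tᵢ₊₁ = 1 + max {t ≥ tᵢ : p t = p tᵢ}`. -/
noncomputable def leTimes {V : Type} (p : ℕ → V) : ℕ → ℕ
  | 0 => 0
  | i + 1 => sSup {t : ℕ | leTimes p i ≤ t ∧ p t = p (leTimes p i)} + 1

/-- The loop-erasure times of the vertex sequence `p` run up to time `k`. -/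
noncomputable def leTimesF {V : Type} (p : ℕ → V) (k : ℕ) : ℕ → ℕ
  | 0 => 0
  | i + 1 => sSup {t : ℕ | leTimesF p k i ≤ t ∧ t ≤ k ∧ p t = p (leTimesF p k i)} + 1

/-- The set of vertices incident to an edge of `A`. -/
def vertsOf {V E : Type} (G : DigraphStruct V E) (A : Set E) : Set V :=
  {u | ∃ e ∈ A, G.src e = u ∨ G.dst e = u}

open Classical in
/-- The set of edges of the loop-erasure of the walk `x` (an edge sequence) stopped when it
first hits `U`; if it never hits `U`, the loop-erasure of the whole (transient) walk. -/
noncomputable def stoppedLEedges {V E : Type} (G : DigraphStruct V E) (U : Set V) (x : ℕ → E) :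
    Set E :=
  if ∃ t : ℕ, G.src (x t) ∈ U then
    {e | ∃ i : ℕ,
      leTimesF (fun t => G.src (x t)) (sInf {t : ℕ | G.src (x t) ∈ U}) i <
          sInf {t : ℕ | G.src (x t) ∈ U} ∧
        x (leTimesF (fun t => G.src (x t)) (sInf {t : ℕ | G.src (x t) ∈ U}) i) = e}
  else Set.range fun i => x (leTimes (fun t => G.src (x t)) i)

/-- The partial edge sets generated by Wilson's algorithm rooted at infinity, run with the
enumeration `v` of the vertices and with `W j` the random walk used at stage `j + 1`
(started at `v j`). -/
noncomputable def wilsonA {V E : Type} (G : DigraphStruct V E) (v : ℕ → V) (W : ℕ → ℕ → E) :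
    ℕ → Set E
  | 0 => ∅
  | j + 1 =>
      wilsonA G v W j ∪
        stoppedLEedges G (vertsOf G (wilsonA G v W j) ∪ {u | ∃ i < j, v i = u}) (W j)

open Classical in
/-- Cylinder probabilities for the random walk on `G` started at `v`, recorded as a sequence of
edges: the probability that the first `n` crossed edges are `x 0, …, x (n-1)`. -/
noncomputable def edgeWalkCyl {V E : Type} (G : DigraphStruct V E) (v : V) (x : ℕ → E) (n : ℕ) :
    ℝ≥0∞ :=
  if (0 < n → G.src (x 0) = v) ∧ (∀ i : ℕ, i + 1 < n → G.dst (x i) = G.src (x (i + 1))) then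
    ∏ i ∈ Finset.range n, ((G.outDeg (G.src (x i)) : ℝ≥0∞))⁻¹
  else 0

/-- `P` is the joint law of a sequence of independent random walks on `G`, the `j`-th walk
started at `v j`. -/
def IsIndepWalksLaw {V E : Type} [MeasurableSpace E] (G : DigraphStruct V E) (v : ℕ → V)
    (P : Measure (ℕ → ℕ → E)) : Prop :=
  P Set.univ = 1 ∧
    ∀ (m n : ℕ) (x : ℕ → ℕ → E),
      P {ω | ∀ j < m, ∀ t < n, ω j t = x j t} =
        ∏ j ∈ Finset.range m, edgeWalkCyl G (v j) (x j) n

/-- `μ` is the law of the random walk on `G` started at `o`, recorded as its sequence of crossed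
edges. -/
def IsEdgeWalkLaw {V E : Type} [MeasurableSpace E] (G : DigraphStruct V E) (o : V)
    (μ : Measure (ℕ → E)) : Prop :=
  μ Set.univ = 1 ∧ ∀ (n : ℕ) (x : ℕ → E), μ {ω | ∀ i < n, ω i = x i} = edgeWalkCyl G o x n

/-! ### Finite approximations and Gibbs measures on arboreta -/

/-- A finite digraph with vertices and edges labelled by natural numbers. -/
structure FinDigraph where
  VS : Finset ℕ
  ES : Finset ℕ
  fsrc : ℕ → ℕ
  fdst : ℕ → ℕ

/-- `B` is a spanning in-arborescence of the finite digraph `H` rooted at `z`. -/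
def FinDigraph.IsArb (H : FinDigraph) (z : ℕ) (B : Finset ℕ) : Prop :=
  B ⊆ H.ES ∧ (∀ e ∈ B, H.fsrc e ≠ z) ∧
  (∀ v ∈ H.VS, v ≠ z → ∃! e : ℕ, e ∈ B ∧ H.fsrc e = v) ∧
  (∀ v ∈ H.VS, Relation.ReflTransGen
      (fun a b => ∃ e ∈ B, H.fsrc e = a ∧ H.fdst e = b) v z)

/-- A finite digraph `H` with a distinguished vertex `z`, together with a partial isomorphism
to a digraph on `(V, E)`: vertex and edge domains `A`, `F` in `H` and maps `φV`, `φE` to `V`, `E`. -/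
structure PIso (V E : Type) where
  H : FinDigraph
  z : ℕ
  A : Finset ℕ
  F : Finset ℕ
  φV : ℕ → V
  φE : ℕ → E

/-- The data of `p` really is a partial isomorphism to `G`. -/
def PIso.Valid {V E : Type} (p : PIso V E) (G : DigraphStruct V E) : Prop :=
  ↑p.A ⊆ ↑p.H.VS ∧ ↑p.F ⊆ ↑p.H.ES ∧ p.z ∈ p.H.VS ∧
  Set.InjOn p.φV ↑p.A ∧ Set.InjOn p.φE ↑p.F ∧
  ∀ e ∈ p.F, p.H.fsrc e ∈ p.A ∧ p.H.fdst e ∈ p.A ∧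
    G.src (p.φE e) = p.φV (p.H.fsrc e) ∧ G.dst (p.φE e) = p.φV (p.H.fdst e)

/-- The partial isomorphism `p` identifies a neighbourhood of (a preimage of) `w`:
`w` is in the range of `φV` and `φE` maps the edges incident to its preimage bijectively onto
the edges incident to `w`. -/
def PIso.GoodAt {V E : Type} (p : PIso V E) (G : DigraphStruct V E) (w : V) : Prop :=
  ∃ w' ∈ p.A, p.φV w' = w ∧
    (∀ e' ∈ p.H.ES, (p.H.fsrc e' = w' ∨ p.H.fdst e' = w') → e' ∈ p.F) ∧
    ∀ e : E, (G.src e = w ∨ G.dst e = w) →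
      ∃! e' : ℕ, e' ∈ p.F ∧ (p.H.fsrc e' = w' ∨ p.H.fdst e' = w') ∧ p.φE e' = e

/-- `a` is a finite approximation to `G`: a sequence of finite digraphs with distinguished
vertices `zₙ` and partial isomorphisms to `G`, identifying larger and larger neighbourhoods of
every finite vertex set, with the distinguished vertices escaping to infinity. -/
def IsFinApproxSeq {V E : Type} (G : DigraphStruct V E) (a : ℕ → PIso V E) : Prop :=
  (∀ n, (a n).Valid G) ∧
  (∀ W : Finset V, ∃ N, ∀ n ≥ N, ∀ w ∈ W, (a n).GoodAt G w) ∧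
  (∀ W : Finset V, ∃ N, ∀ n ≥ N, ¬((a n).z ∈ (a n).A ∧ (a n).φV (a n).z ∈ (W : Set V)))

/-- The probability, under the uniform spanning in-arborescence of `p.H` rooted at `p.z`, that
every edge of `F` is in the image of the arborescence under the partial isomorphism. -/
noncomputable def pisoUACyl {V E : Type} (p : PIso V E) (F : Finset E) :
    ℝ≥0∞ :=
  (Nat.card {B : Finset ℕ // p.H.IsArb p.z B ∧ ∀ e ∈ F, ∃ e' ∈ B, e' ∈ p.F ∧ p.φE e' = e} :
      ℝ≥0∞) /
    (Nat.card {B : Finset ℕ // p.H.IsArb p.z B} : ℝ≥0∞)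

/-- `μ` (a measure on edge sets, encoded as elements of `E → Bool`) is a Gibbs measure on
spanning in-arboreta of `G` rooted at infinity: it is a weak limit of mixtures (over a random
finite approximation to `G`) of uniform spanning in-arborescence measures on finite
approximations to `G`. -/
def IsArbGibbs {V E : Type} (G : DigraphStruct V E) (μ : Measure (E → Bool)) : Prop :=
  μ Set.univ = 1 ∧
  ∃ (Ω : Type) (mΩ : MeasurableSpace Ω) (ν : @Measure Ω mΩ) (a : Ω → ℕ → PIso V E),
    ν Set.univ = 1 ∧ (∀ ω : Ω, IsFinApproxSeq G (a ω)) ∧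
    ∀ F : Finset E,
      Filter.Tendsto (fun n => ∫⁻ ω, pisoUACyl (a ω n) F ∂ν) Filter.atTop
        (nhds (μ {A : E → Bool | ∀ e ∈ F, A e = true}))

/-! ### Stacks -/

open Classical in
/-- The state (current vertex, remaining stacks) after `n` steps of following the stacks `σ`
starting from `o`: at each step we cross the edge at the front of the list at the current vertex
and delete it from the list (doing nothing if the list is empty). -/
noncomputable def stackState {V E : Type} (G : DigraphStruct V E) (o : V) (σ : V → List E) :
    ℕ → V × (V → List E)
  | 0 => (o, σ)
  | n + 1 =>
    let p := stackState G o σ n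
    match p.2 p.1 with
    | [] => p
    | e :: rest => (G.dst e, Function.update p.2 p.1 rest)

/-- The edge crossed at step `n` when following the stacks `σ` from `o` (`none` if the
current stack is exhausted). -/
noncomputable def stackEdge {V E : Type} (G : DigraphStruct V E) (o : V) (σ : V → List E)
    (n : ℕ) : Option E :=
  ((stackState G o σ n).2 (stackState G o σ n).1).head?

/-- The sigma-algebra on stack configurations. -/
noncomputable def stackMS (V E : Type) : MeasurableSpace (V → List E) :=
  @MeasurableSpace.pi V (fun _ => List E) fun _ => ⊤

open Classical in
/-- `ρ` is the law of the random stack configuration built from a random arboretum with law `κ`: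
place the arboretum edge at the bottom of the stack at each vertex, and an independent,
uniformly random ordering of the remaining outgoing edges on top of it. -/
def IsStackLaw {V E : Type} (G : DigraphStruct V E) (κ : Measure (E → Bool))
    (ρ : @Measure (V → List E) (stackMS V E)) : Prop :=
  ρ Set.univ = 1 ∧
    ∀ (K : Finset V) (s : V → List E),
      ρ {σ | ∀ v ∈ K, σ v = s v} =
        if ∀ v ∈ K, (s v).Nodup ∧ ∀ e : E, e ∈ s v ↔ G.src e = v then
          κ {A | ∀ v ∈ K, ∃ e : E, (s v).getLast? = some e ∧ A e = true} *
            ∏ v ∈ K, (((G.outDeg v - 1).factorial : ℝ≥0∞))⁻¹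
        else 0

/-! ### Markov chains -/

open Classical in
/-- `ν` is the law of the trajectory of a Markov chain with state space `S' ⊆ S`, transition
kernel `p` and deterministic initial state `s0`. -/
def IsMCLaw {S : Type} [MeasurableSpace S] (S' : Set S) (p : S → S → ℝ≥0∞) (s0 : S)
    (ν : Measure (ℕ → S)) : Prop :=
  ν Set.univ = 1 ∧ s0 ∈ S' ∧
  (∀ u ∈ S', (∑' v : S, p u v) = 1 ∧ ∀ v : S, p u v ≠ 0 → v ∈ S') ∧
  (∀ u : S, u ∉ S' → ∀ v : S, p u v = 0) ∧
  ∀ (n : ℕ) (y : ℕ → S),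
    ν {x | ∀ i ≤ n, x i = y i} =
      if y 0 = s0 then ∏ i ∈ Finset.range n, p (y i) (y (i + 1)) else 0

/-- `ν` is the law of the trajectory of a recurrent Markov chain on a subset of `S` with
non-random initial state: the chain returns to its initial state infinitely often a.s. -/
def IsRecMCLaw {S : Type} [MeasurableSpace S] (ν : Measure (ℕ → S)) : Prop :=
  ∃ (S' : Set S) (p : S → S → ℝ≥0∞) (s0 : S),
    IsMCLaw S' p s0 ν ∧ ν {x | {i : ℕ | x i = s0}.Infinite} = 1

/-- `ν` is the law of the sequence of vertices visited by (the unique) proper Gibbs measure on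
Eulerian paths from `o` to `∞` on a sourced Eulerian digraph whose vertex set is a subset
of `S`. -/
def IsGibbsVertexLaw {S : Type} [MeasurableSpace S] (ν : Measure (ℕ → S)) : Prop :=
  ∃ (Vs : Set S) (E : Type) (mE : MeasurableSpace E) (G : DigraphStruct (↥Vs) E) (o : ↥Vs),
    Countable E ∧ G.IsSourcedEulerian o ∧
    ∃ μp : @Measure (ℕ → E) (@MeasurableSpace.pi ℕ (fun _ => E) fun _ => mE),
      @ProperGibbs (↥Vs) E mE G o μp ∧
      ∀ A : Set (ℕ → S), MeasurableSet A →
        ν A = μp ((fun (γ : ℕ → E) (i : ℕ) => ((G.src (γ i) : S))) ⁻¹' A)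

/-- Concatenation of a finite list with an infinite sequence. -/
def concatSeq {S : Type} (l : List S) (y : ℕ → S) : ℕ → S :=
  fun i => if h : i < l.length then l.get ⟨i, h⟩ else y (i - l.length)

/-- `ν` is the law of a process following a uniform random Eulerian path on a finite Eulerian
digraph with source and sink whose vertex set is a subset of `S`, followed by the trajectory of
an (independent) recurrent Markov chain on a disjoint subset of `S` with non-random initial
state. -/
def IsMixedLaw {S : Type} [MeasurableSpace S] (ν : Measure (ℕ → S)) : Prop :=
  ∃ (Vf : Finset S) (Ef : Type) (_ : Finite Ef)
    (Gf : DigraphStruct {s : S // s ∈ Vf} Ef) (of zf : {s : S // s ∈ Vf})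
    (Vr : Set S) (p : S → S → ℝ≥0∞) (s1 : S) (νMC : Measure (ℕ → S)),
    IsFinEulerian Gf of zf ∧ Disjoint (↑Vf : Set S) Vr ∧
    IsMCLaw Vr p s1 νMC ∧ νMC {x | {i : ℕ | x i = s1}.Infinite} = 1 ∧
    ∀ A : Set (ℕ → S), MeasurableSet A →
      ν A =
        (∑' L : {L : List Ef // IsEulerList Gf of zf L},
            νMC ((fun y => concatSeq (((of : S)) ::
              (L : List Ef).map fun e => ((Gf.dst e : S))) y) ⁻¹' A)) /
          (Nat.card {L : List Ef // IsEulerList Gf of zf L} : ℝ≥0∞)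

/-! ### Proof of transience -/

section Transience

open Classical in
/-- `ncard` of a finite set as a sum of indicators. -/
lemma ncard_eq_tsum {E : Type} (s : Set E) (hs : s.Finite) :
    (s.ncard : ℝ≥0∞) = ∑' e : E, if e ∈ s then 1 else 0 := by
  have h1 : (∑' e : E, if e ∈ s then (1 : ℝ≥0∞) else 0) = ∑ e ∈ hs.toFinset, 1 := by
    rw [tsum_eq_sum (s := hs.toFinset)]
    · apply Finset.sum_congr rfl
      intro e he
      have : e ∈ s := by simpa using he
      simp [this]
    · intro e he
      have : e ∉ s := by simpa using he
      simp [this]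
  rw [h1, Set.ncard_eq_toFinset_card s hs]
  simp

variable {V E : Type} (G : DigraphStruct V E)

/-- The transition operator. -/
noncomputable def walkOp (f : V → ℝ≥0∞) (x : V) : ℝ≥0∞ := ∑' y, G.stepProb x y * f y

open Classical in
/-- The `n`-step probabilities of being at `v`, as a function of the starting point. -/
noncomputable def walkQ (v : V) : ℕ → V → ℝ≥0∞
  | 0 => fun x => if x = v then 1 else 0
  | n + 1 => walkOp G (walkQ v n)

/-- Truncated Green function. -/
noncomputable def walkG (v : V) (N : ℕ) (x : V) : ℝ≥0∞ := ∑ n ∈ Finset.range N, walkQ G v n x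

lemma edges_finite (hG : G.LocallyFinite) (A : Set V) (y : V) :
    {e : E | G.src e ∈ A ∧ G.dst e = y}.Finite :=
  (hG y).2.subset fun _ he => he.2

open Classical in
lemma sum_edges (hG : G.LocallyFinite) (A : Set V) (y : V) :
    (∑' z : V, if z ∈ A then ({e : E | G.src e = z ∧ G.dst e = y}.ncard : ℝ≥0∞) else 0)
      = ({e : E | G.src e ∈ A ∧ G.dst e = y}.ncard : ℝ≥0∞) := by
  rw [ncard_eq_tsum _ (edges_finite G hG A y)]
  have h : ∀ z : V, (if z ∈ A then ({e : E | G.src e = z ∧ G.dst e = y}.ncard : ℝ≥0∞) else 0)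
      = ∑' e : E, if z = G.src e then (if G.src e ∈ A ∧ G.dst e = y then 1 else 0) else 0 := by
    intro z
    by_cases hz : z ∈ A
    · rw [if_pos hz, ncard_eq_tsum _ ((hG y).2.subset fun _ he => he.2)]
      apply tsum_congr
      intro e
      by_cases h1 : z = G.src e
      · subst h1; simp [hz]
      · have : G.src e ≠ z := fun h => h1 h.symm
        simp [h1, this]
    · rw [if_neg hz]
      symm
      rw [ENNReal.tsum_eq_zero]
      intro e
      by_cases h1 : z = G.src e
      · subst h1; simp [hz]
      · simp [h1]
  simp_rw [h]
  rw [ENNReal.tsum_comm]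
  apply tsum_congr
  intro e
  rw [tsum_ite_eq]
  simp

open Classical in
lemma stepProb_sum_le (hG : G.LocallyFinite) (x : V) : ∑' y, G.stepProb x y ≤ 1 := by
  have h : ∑' y : V, ({e : E | G.src e = x ∧ G.dst e = y}.ncard : ℝ≥0∞) = (G.outDeg x : ℝ≥0∞) := by
    unfold DigraphStruct.outDeg
    rw [ncard_eq_tsum _ (hG x).1]
    have h : ∀ y : V, ({e : E | G.src e = x ∧ G.dst e = y}.ncard : ℝ≥0∞)
      = ∑' e : E, if y = G.dst e then (if G.src e = x then 1 else 0) else 0 := by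
      intro y
      rw [ncard_eq_tsum _ ((hG x).1.subset fun _ he => he.1)]
      apply tsum_congr
      intro e
      by_cases h1 : y = G.dst e
      · subst h1; simp
      · have : G.dst e ≠ y := fun h => h1 h.symm
        simp [h1, this]
    simp_rw [h]
    rw [ENNReal.tsum_comm]
    apply tsum_congr
    intro e
    rw [tsum_ite_eq]
    by_cases hs : G.src e = x <;> simp [DigraphStruct.outEdges, hs]
  unfold DigraphStruct.stepProb
  simp_rw [div_eq_mul_inv]
  rw [ENNReal.tsum_mul_right, h, ← div_eq_mul_inv]
  exact ENNReal.div_self_le_one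

lemma stepProb_le_one (hG : G.LocallyFinite) (x y : V) : G.stepProb x y ≤ 1 :=
  (ENNReal.le_tsum y).trans (stepProb_sum_le G hG x)

lemma stepProb_pos (hG : G.LocallyFinite) {x y : V} (h : G.dirAdj x y) : 0 < G.stepProb x y := by
  obtain ⟨e, he⟩ := h
  unfold DigraphStruct.stepProb
  apply ENNReal.div_pos
  · have : 0 < {e : E | G.src e = x ∧ G.dst e = y}.ncard :=
      (Set.ncard_pos ((hG x).1.subset fun _ he => he.1)).2 ⟨e, he⟩
    exact_mod_cast this.ne'
  · exact ENNReal.natCast_ne_top _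

open Classical in
lemma walkG_succ (v : V) (N : ℕ) (x : V) :
    walkG G v (N + 1) x = walkOp G (walkG G v N) x + if x = v then 1 else 0 := by
  unfold walkG
  rw [Finset.sum_range_succ']
  congr 1
  simp only [walkQ, walkOp]
  rw [← Summable.tsum_finsetSum (fun _ _ => ENNReal.summable)]
  apply tsum_congr
  intro y
  rw [Finset.mul_sum]

lemma walkG_mono (v : V) (N : ℕ) (x : V) : walkG G v N x ≤ walkG G v (N + 1) x := by
  unfold walkG
  rw [Finset.sum_range_succ]
  exact le_self_add

lemma walkOp_le (hG : G.LocallyFinite) (f : V → ℝ≥0∞) (M : ℝ≥0∞) (hf : ∀ y, f y ≤ M) (x : V) :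
    walkOp G f x ≤ M := by
  calc walkOp G f x ≤ ∑' y, G.stepProb x y * M :=
        ENNReal.tsum_le_tsum fun y => mul_le_mul_right (hf y) _
    _ = (∑' y, G.stepProb x y) * M := ENNReal.tsum_mul_right
    _ ≤ 1 * M := mul_le_mul_left (stepProb_sum_le G hG x) _
    _ = M := one_mul _

/-- Maximum principle. -/
lemma walkG_le_diag (hG : G.LocallyFinite) (v : V) (N : ℕ) (x : V) :
    walkG G v N x ≤ walkG G v N v := by
  induction N generalizing x with
  | zero => simp [walkG]
  | succ N ih =>
    by_cases h : x = v
    · rw [h]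
    · rw [walkG_succ, if_neg h, add_zero]
      exact (walkOp_le G hG _ _ ih x).trans (walkG_mono G v N v)

lemma walkG_ne_top (hG : G.LocallyFinite) (v : V) (N : ℕ) (x : V) : walkG G v N x ≠ ⊤ := by
  have h : ∀ n, ∀ y, walkQ G v n y ≤ 1 := by
    intro n
    induction n with
    | zero => intro y; simp only [walkQ]; split_ifs <;> simp
    | succ n ih => intro y; exact walkOp_le G hG _ _ ih y
  unfold walkG
  exact ENNReal.sum_ne_top.2 fun n _ => ((h n x).trans_lt ENNReal.one_lt_top).ne

open Classical in
lemma walkOp_add_le (hG : G.LocallyFinite) (f : V → ℝ≥0∞) (M : ℝ≥0∞) (hf : ∀ y, f y ≤ M)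
    (x y : V) : walkOp G f x + G.stepProb x y * M ≤ M + G.stepProb x y * f y := by
  have e1 : ∀ c : ℝ≥0∞, c = ∑' z : V, if z = y then c else 0 := fun c => by rw [tsum_ite_eq]
  calc walkOp G f x + G.stepProb x y * M
      = ∑' z, (G.stepProb x z * f z + if z = y then G.stepProb x y * M else 0) := by
        rw [ENNReal.tsum_add, ← e1]; rfl
    _ ≤ ∑' z, (G.stepProb x z * M + if z = y then G.stepProb x y * f y else 0) := by
        apply ENNReal.tsum_le_tsum
        intro z
        by_cases h : z = y
        · subst h; simp [add_comm]
        · simp only [h, if_false, add_zero]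
          exact mul_le_mul_right (hf z) _
    _ = (∑' z, G.stepProb x z) * M + G.stepProb x y * f y := by
        rw [ENNReal.tsum_add, ← e1, ENNReal.tsum_mul_right]
    _ ≤ M + G.stepProb x y * f y := by
        gcongr
        calc (∑' z, G.stepProb x z) * M ≤ 1 * M := mul_le_mul_left (stepProb_sum_le G hG x) _
          _ = M := one_mul _

lemma reach_bound (hG : G.LocallyFinite) (v w : V) (K : ℝ≥0∞) (hK : K ≠ ⊤)
    (hw : ∀ N, walkG G v N w ≤ K) (x : V) (hx : Relation.ReflTransGen G.dirAdj x w) :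
    ∃ a L : ℝ≥0∞, a ≠ 0 ∧ L ≠ ⊤ ∧
      ∀ N, walkG G v N x + a * walkG G v N v ≤ walkG G v N v + L := by
  induction hx using Relation.ReflTransGen.head_induction_on with
  | refl =>
    refine ⟨1, K, one_ne_zero, hK, fun N => ?_⟩
    rw [one_mul, add_comm]
    gcongr
    exact hw N
  | head h hyw ih =>
    rename_i x y
    obtain ⟨a, L, ha, hL, hb⟩ := ih
    have hp := stepProb_pos G hG h
    have hp1 : G.stepProb x y ≠ ⊤ :=
      ((stepProb_le_one G hG x y).trans_lt ENNReal.one_lt_top).ne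
    refine ⟨G.stepProb x y * a, 1 + G.stepProb x y * L, mul_ne_zero hp.ne' ha,
      ENNReal.add_ne_top.2 ⟨ENNReal.one_ne_top, ENNReal.mul_ne_top hp1 hL⟩, fun N => ?_⟩
    set p := G.stepProb x y
    set M := walkG G v N v with hM
    have hMt : M ≠ ⊤ := walkG_ne_top G hG v N v
    have h1 : walkG G v N x ≤ walkOp G (walkG G v N) x + 1 := by
      refine (walkG_mono G v N x).trans ?_
      rw [walkG_succ]
      gcongr
      split_ifs <;> simp
    have h2 : walkOp G (walkG G v N) x + p * M ≤ M + p * walkG G v N y :=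
      walkOp_add_le G hG _ M (walkG_le_diag G hG v N) x y
    have h3 : p * (walkG G v N y + a * M) ≤ p * (M + L) := mul_le_mul_right (hb N) _
    have h4 : (walkG G v N x + p * a * M) + p * M ≤ (M + (1 + p * L)) + p * M := by
      calc (walkG G v N x + p * a * M) + p * M
          ≤ (walkOp G (walkG G v N) x + 1 + p * a * M) + p * M := by gcongr
        _ = (walkOp G (walkG G v N) x + p * M) + 1 + p * a * M := by ring
        _ ≤ (M + p * walkG G v N y) + 1 + p * a * M := by gcongr
        _ = M + 1 + p * (walkG G v N y + a * M) := by ring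
        _ ≤ M + 1 + p * (M + L) := by gcongr
        _ = _ := by ring
    exact (ENNReal.add_le_add_iff_right (ENNReal.mul_ne_top hp1 hMt)).1 h4

lemma diag_finite (hG : G.LocallyFinite) (v w : V) (K : ℝ≥0∞) (hK : K ≠ ⊤)
    (hw : ∀ N, walkG G v N w ≤ K) (hx : Relation.ReflTransGen G.dirAdj v w) :
    ∃ C : ℝ≥0∞, C ≠ ⊤ ∧ ∀ N x, walkG G v N x ≤ C := by
  obtain ⟨a, L, ha, hL, hb⟩ := reach_bound G hG v w K hK hw v hx
  refine ⟨L / a, ENNReal.div_ne_top hL ha, fun N x => (walkG_le_diag G hG v N x).trans ?_⟩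
  have h1 : a * walkG G v N v ≤ L :=
    (ENNReal.add_le_add_iff_left (walkG_ne_top G hG v N v)).1 (hb N)
  rw [ENNReal.le_div_iff_mul_le (Or.inl ha) (Or.inr hL), mul_comm]
  exact h1

/-- The set reachable from `v` contains a vertex with strictly positive source. -/
lemma exists_source {o : V} (hG : G.IsSourcedEulerian o) (v : V) :
    ∃ w, Relation.ReflTransGen G.dirAdj v w ∧
      {e : E | G.src e ∈ {z | Relation.ReflTransGen G.dirAdj v z} ∧ G.dst e = w}.ncard + 1
        ≤ G.outDeg w := by
  have hsub : ∀ w, {e : E | G.src e ∈ {z | Relation.ReflTransGen G.dirAdj v z} ∧ G.dst e = w}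
      ⊆ G.inEdges w := fun w e he => he.2
  by_cases ho : Relation.ReflTransGen G.dirAdj v o
  · refine ⟨o, ho, ?_⟩
    rw [hG.source]
    exact Nat.succ_le_succ (Set.ncard_le_ncard (hsub o) (hG.locFin o).2)
  · have key : ∀ z, Relation.ReflTransGen G.undirAdj v z → ¬ Relation.ReflTransGen G.dirAdj v z →
        ∃ w, Relation.ReflTransGen G.dirAdj v w ∧ ∃ e, G.dst e = w ∧
          ¬ Relation.ReflTransGen G.dirAdj v (G.src e) := by
      intro z hz
      induction hz with
      | refl => intro h; exact absurd Relation.ReflTransGen.refl h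
      | tail hvb hbc ih =>
        rename_i b c
        intro hc
        by_cases hb : Relation.ReflTransGen G.dirAdj v b
        · obtain ⟨e, he | he⟩ := hbc
          · exact absurd (hb.tail ⟨e, he⟩) hc
          · exact ⟨b, hb, e, he.2, by rw [he.1]; exact hc⟩
        · exact ih hb
    obtain ⟨w, hw, e, he, hne⟩ := key o (hG.conn v o) ho
    refine ⟨w, hw, ?_⟩
    have hwo : w ≠ o := fun h => ho (h ▸ hw)
    rw [← hG.balanced w hwo]
    apply Nat.succ_le_of_lt
    apply Set.ncard_lt_ncard _ (hG.locFin w).2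
    refine ⟨hsub w, fun h => hne ?_⟩
    exact (h (show e ∈ G.inEdges w from he)).1

open Classical in
/-- The degree measure restricted to the set reachable from `v`. -/
noncomputable def rho (v z : V) : ℝ≥0∞ :=
  if z ∈ {z | Relation.ReflTransGen G.dirAdj v z} then (G.outDeg z : ℝ≥0∞) else 0

open Classical in
lemma rho_step {o : V} (hG : G.IsSourcedEulerian o) (v y : V) :
    ∑' z, rho G v z * G.stepProb z y ≤
      ({e : E | G.src e ∈ {z | Relation.ReflTransGen G.dirAdj v z} ∧ G.dst e = y}.ncard
        : ℝ≥0∞) := by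
  rw [← sum_edges G hG.locFin]
  apply ENNReal.tsum_le_tsum
  intro z
  unfold rho
  split_ifs
  · unfold DigraphStruct.stepProb
    exact ENNReal.mul_div_le
  · simp

lemma rho_step_le {o : V} (hG : G.IsSourcedEulerian o) (v y : V) :
    ∑' z, rho G v z * G.stepProb z y ≤ rho G v y := by
  refine (rho_step G hG v y).trans ?_
  unfold rho
  split_ifs with h
  · have h1 : {e : E | G.src e ∈ {z | Relation.ReflTransGen G.dirAdj v z} ∧ G.dst e = y}.ncard
        ≤ G.inDeg y := Set.ncard_le_ncard (fun e he => he.2) (hG.locFin y).2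
    have h2 : G.inDeg y ≤ G.outDeg y := by
      by_cases hy : y = o
      · rw [hy, hG.source]; exact Nat.le_succ _
      · exact (hG.balanced y hy).le
    exact_mod_cast h1.trans h2
  · have : {e : E | G.src e ∈ {z | Relation.ReflTransGen G.dirAdj v z} ∧ G.dst e = y} = ∅ := by
      ext e
      simp only [Set.mem_ofPred_eq, Set.mem_empty_iff_false, iff_false]
      rintro ⟨h1, h2⟩
      exact h (h1.tail ⟨e, rfl, h2⟩)
    rw [this]
    simp

open Classical in
lemma rho_pair {o : V} (hG : G.IsSourcedEulerian o) (v w : V)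
    (hw : Relation.ReflTransGen G.dirAdj v w)
    (hw1 : {e : E | G.src e ∈ {z | Relation.ReflTransGen G.dirAdj v z} ∧ G.dst e = w}.ncard + 1
        ≤ G.outDeg w) (f : V → ℝ≥0∞) :
    f w + ∑' z, rho G v z * walkOp G f z ≤ ∑' z, rho G v z * f z := by
  have h1 : ∑' z, rho G v z * walkOp G f z
      = ∑' y, (∑' z, rho G v z * G.stepProb z y) * f y := by
    unfold walkOp
    simp_rw [← ENNReal.tsum_mul_left, ← ENNReal.tsum_mul_right]
    rw [ENNReal.tsum_comm]
    simp_rw [mul_assoc]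
  have h2 : f w = ∑' y, if y = w then f w else 0 := by rw [tsum_ite_eq]
  rw [h1, h2, ← ENNReal.tsum_add]
  apply ENNReal.tsum_le_tsum
  intro y
  by_cases hy : y = w
  · subst hy
    simp only [if_true]
    have : 1 + ∑' z, rho G v z * G.stepProb z y ≤ rho G v y := by
      refine (add_le_add_right (rho_step G hG v y) 1).trans ?_
      have e : rho G v y = (G.outDeg y : ℝ≥0∞) := if_pos hw
      rw [e, add_comm]
      exact_mod_cast hw1
    calc _ = (1 + ∑' z, rho G v z * G.stepProb z y) * f y := by ring
      _ ≤ _ := mul_le_mul_left this _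
  · simp only [hy, if_false, zero_add]
    exact mul_le_mul_left (rho_step_le G hG v y) _

open Classical in
lemma source_green {o : V} (hG : G.IsSourcedEulerian o) (v w : V)
    (hw : Relation.ReflTransGen G.dirAdj v w)
    (hw1 : {e : E | G.src e ∈ {z | Relation.ReflTransGen G.dirAdj v z} ∧ G.dst e = w}.ncard + 1
        ≤ G.outDeg w) (N : ℕ) : walkG G v N w ≤ rho G v v := by
  have h : ∀ N, walkG G v N w + ∑' z, rho G v z * walkQ G v N z ≤ rho G v v := by
    intro N
    induction N with
    | zero =>
      simp only [walkG, Finset.range_zero, Finset.sum_empty, zero_add, walkQ, mul_ite, mul_one,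
        mul_zero]
      rw [tsum_ite_eq]
    | succ N ih =>
      refine le_trans ?_ ih
      have := rho_pair G hG v w hw hw1 (walkQ G v N)
      have e : walkG G v (N + 1) w = walkG G v N w + walkQ G v N w := by
        unfold walkG; rw [Finset.sum_range_succ]
      rw [e, add_assoc]
      gcongr
      exact this
  exact le_self_add.trans (h N)

lemma green_finite {o : V} (hG : G.IsSourcedEulerian o) (v u : V) :
    ∑' n, walkQ G v n u ≠ ⊤ := by
  obtain ⟨w, hw, hw1⟩ := exists_source G hG v
  have hr : rho G v v ≠ ⊤ := by
    unfold rho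
    split_ifs
    · exact ENNReal.natCast_ne_top _
    · simp
  obtain ⟨C, hC, hb⟩ := diag_finite G hG.locFin v w _ hr (source_green G hG v w hw hw1) hw
  refine ne_top_of_le_ne_top hC ?_
  rw [ENNReal.tsum_eq_iSup_nat]
  exact iSup_le fun N => hb N u

open Classical in
lemma cyl_bound [Countable V] [MeasurableSpace V] (u v : V) (μ : Measure (ℕ → V))
    (hμ : G.IsWalkLaw u μ) (n m : ℕ) (x : ℕ → V) :
    μ {ω | (∀ i ≤ m, ω i = x i) ∧ ω (m + n) = v} ≤
      (if x 0 = u then ∏ i ∈ Finset.range m, G.stepProb (x i) (x (i + 1)) else 0)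
        * walkQ G v n (x m) := by
  induction n generalizing m x with
  | zero =>
    by_cases h : x m = v
    · simp only [walkQ, h, if_true, mul_one]
      rw [← hμ.2 m x]
      exact measure_mono fun ω hω => hω.1
    · have : {ω : ℕ → V | (∀ i ≤ m, ω i = x i) ∧ ω (m + 0) = v} = ∅ := by
        ext ω
        simp only [Set.mem_ofPred_eq, Set.mem_empty_iff_false, iff_false]
        rintro ⟨h1, h2⟩
        exact h (by rw [← h1 m le_rfl]; exact h2)
      rw [this]
      simp
  | succ n ih =>
    have hsub : {ω : ℕ → V | (∀ i ≤ m, ω i = x i) ∧ ω (m + (n + 1)) = v} ⊆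
        ⋃ y : V, {ω : ℕ → V | (∀ i ≤ m + 1, ω i = Function.update x (m + 1) y i) ∧
          ω (m + 1 + n) = v} := by
      rintro ω ⟨h1, h2⟩
      refine Set.mem_iUnion.2 ⟨ω (m + 1), ?_, ?_⟩
      · intro i hi
        by_cases h : i = m + 1
        · subst h; simp
        · rw [Function.update_of_ne h]
          exact h1 i (by omega)
      · rw [← h2]; congr 1; omega
    refine (measure_mono hsub).trans ((measure_iUnion_le _).trans ?_)
    simp only [walkQ, walkOp]
    rw [← ENNReal.tsum_mul_left]
    apply ENNReal.tsum_le_tsum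
    intro y
    refine (ih (m + 1) _).trans (le_of_eq ?_)
    rw [Finset.prod_range_succ, Function.update_self, Function.update_of_ne (by omega),
      Function.update_of_ne (by omega)]
    have : ∏ i ∈ Finset.range m, G.stepProb (Function.update x (m + 1) y i)
        (Function.update x (m + 1) y (i + 1))
        = ∏ i ∈ Finset.range m, G.stepProb (x i) (x (i + 1)) := by
      apply Finset.prod_congr rfl
      intro i hi
      have := Finset.mem_range.1 hi
      rw [Function.update_of_ne (by omega), Function.update_of_ne (by omega)]
    rw [this]
    split_ifs
    · rw [mul_assoc]
    · simp

open Classical in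
lemma visit_bound [Countable V] [MeasurableSpace V] (u v : V) (μ : Measure (ℕ → V))
    (hμ : G.IsWalkLaw u μ) (n : ℕ) : μ {ω | ω n = v} ≤ walkQ G v n u := by
  have hsub : {ω : ℕ → V | ω n = v} ⊆
      ⋃ y : V, {ω : ℕ → V | (∀ i ≤ 0, ω i = (fun _ => y : ℕ → V) i) ∧ ω (0 + n) = v} := by
    intro ω h
    refine Set.mem_iUnion.2 ⟨ω 0, ?_, ?_⟩
    · intro i hi
      rw [Nat.le_zero.1 hi]
    · rw [zero_add]; exact h
  refine (measure_mono hsub).trans ((measure_iUnion_le _).trans ?_)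
  calc _ ≤ ∑' y, if y = u then walkQ G v n u else 0 := by
        apply ENNReal.tsum_le_tsum
        intro y
        refine (cyl_bound G u v μ hμ n 0 (fun _ => y)).trans (le_of_eq ?_)
        by_cases h : y = u
        · subst h; simp
        · simp [h]
    _ = _ := by rw [tsum_ite_eq]

end Transience

/-- Every infinite sourced Eulerian digraph is transient: the random walk
visits every vertex at most finitely often almost surely, from every starting vertex. -/
theorem stmt10 {V E : Type} [Countable V] [Countable E] [MeasurableSpace V]
    [DiscreteMeasurableSpace V]
    (G : DigraphStruct V E) (o : V) (hG : G.IsSourcedEulerian o) :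
    G.TransientDigraph := by
  intro u μ hμ
  have h : ∀ᵐ ω ∂μ, ∀ v : V, {i : ℕ | ω i = v}.Finite := by
    rw [ae_all_iff]
    intro v
    have hs : ∑' n, μ {ω : ℕ → V | ω n = v} ≠ ⊤ :=
      ne_top_of_le_ne_top (green_finite G hG v u)
        (ENNReal.tsum_le_tsum fun n => visit_bound G u v μ hμ n)
    exact ae_finite_setOfPred_mem hs
  rw [← hμ.1]
  exact measure_congr (eventuallyEq_univ.2 h)

end DF
end

section
/- Let G be a locally finite digraph in which every vertex has in-degree at most its out-degree, and let o be a vertex with out-degree at least 1. Then the probability that the random walk on G started at o ever returns to o is at most in-deg(o)/out-deg(o). In particular, if out-deg(o) > in-deg(o) then the walk started at o fails to return to o with positive probability. -/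
open MeasureTheory Filter Set
open scoped ENNReal

namespace DF

/-! ### Sequences over a countable state space -/

variable {S : Type}

/-- Number of edges from `u` to `v`. -/
noncomputable def nEdges {V E : Type} (G : DigraphStruct V E) (u v : V) : ℝ≥0∞ :=
  ({e : E | G.src e = u ∧ G.dst e = v}.ncard : ℝ≥0∞)

open Classical in
lemma tsum_nEdges_le {V E : Type} (G : DigraphStruct V E) (hlf : G.LocallyFinite) (v : V) :
    ∑' u, nEdges G u v ≤ (G.inDeg v : ℝ≥0∞) := by
  set s : Finset E := (hlf v).2.toFinset with hs
  have h1 : ∀ u, nEdges G u v = ((s.filter (fun e => G.src e = u)).card : ℝ≥0∞) := by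
    intro u
    unfold nEdges
    congr 1
    rw [← Set.ncard_coe_finset]
    congr 1
    ext e
    simp [hs, DigraphStruct.inEdges, and_comm]
  have h2 : G.inDeg v = s.card := by
    unfold DigraphStruct.inDeg
    rw [Set.ncard_eq_toFinset_card _ (hlf v).2]
  rw [h2, Finset.card_eq_sum_card_image G.src s]
  rw [tsum_eq_sum (s := s.image G.src)]
  · push_cast
    exact (Finset.sum_congr rfl fun u _ => h1 u).le
  · intro u hu
    rw [h1, Finset.filter_eq_empty_iff.2]
    · simp
    · intro e he h
      exact hu (Finset.mem_image.2 ⟨e, he, h⟩)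

/-- The avoiding set: no return to `o` during times `1,…,n`, and position `u` at time `n`. -/
def avoidSet {V : Type} (o : V) (n : ℕ) (u : V) : Set (ℕ → V) :=
  {ω | (∀ i, 1 ≤ i → i ≤ n → ω i ≠ o) ∧ ω n = u}

lemma avoid_step {V E : Type} [Countable V] [MeasurableSpace V]
    [DiscreteMeasurableSpace V]
    (G : DigraphStruct V E) (o : V)
    (μ : Measure (ℕ → V)) (hμ : G.IsWalkLaw o μ) (n : ℕ) (u v : V) :
    μ (avoidSet o n u ∩ {ω | ω (n + 1) = v}) ≤ μ (avoidSet o n u) * G.stepProb u v := by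
  classical
  let pr : (ℕ → V) → (Fin (n + 1) → V) := fun ω i => ω i
  let ex : (Fin (n + 1) → V) → ℕ → V := fun a i => if h : i < n + 1 then a ⟨i, h⟩ else v
  have hprm : Measurable pr := by fun_prop
  have hex : ∀ a i (h : i < n + 1), ex a i = a ⟨i, h⟩ := fun a i h => dif_pos h
  have hexv : ∀ a, ex a (n + 1) = v := fun a => by simp [ex]
  have hcyl : ∀ a, pr ⁻¹' {a} = {ω | ∀ i ≤ n, ω i = ex a i} := by
    intro a
    ext ω
    simp only [Set.mem_preimage, Set.mem_singleton_iff, Set.mem_ofPred_eq, funext_iff, pr]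
    constructor
    · intro h i hi
      rw [hex a i (by omega), ← h]
    · intro h i
      rw [h i (by omega), hex a i i.2]
  have hA : MeasurableSet (avoidSet o n u) := by
    have : avoidSet o n u = (⋂ i : ℕ, ⋂ (_ : 1 ≤ i), ⋂ (_ : i ≤ n),
        (fun ω : ℕ → V => ω i) ⁻¹' {o}ᶜ) ∩ (fun ω : ℕ → V => ω n) ⁻¹' {u} := by
      ext ω
      simp [avoidSet]
    rw [this]
    refine MeasurableSet.inter (MeasurableSet.iInter fun i => MeasurableSet.iInter fun _ =>
      MeasurableSet.iInter fun _ => ?_) ?_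
    · exact measurable_pi_apply i (MeasurableSet.of_discrete)
    · exact measurable_pi_apply n (MeasurableSet.of_discrete)
  have hdec : ∀ B : Set (ℕ → V), B = ⋃ a, B ∩ pr ⁻¹' {a} := by
    intro B
    ext ω
    simp
  have hsum : μ (avoidSet o n u) = ∑' a, μ (avoidSet o n u ∩ pr ⁻¹' {a}) := by
    conv_lhs => rw [hdec (avoidSet o n u)]
    rw [measure_iUnion]
    · intro a b hab
      refine Set.disjoint_left.2 ?_
      rintro ω ⟨_, h1⟩ ⟨_, h2⟩
      exact hab (h1.symm.trans h2)
    · intro a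
      exact hA.inter (hprm (measurableSet_singleton a))
  rw [hsum, ← ENNReal.tsum_mul_right]
  conv_lhs => rw [hdec (avoidSet o n u ∩ {ω | ω (n + 1) = v})]
  refine (measure_iUnion_le _).trans (ENNReal.tsum_le_tsum fun a => ?_)
  by_cases h : ex a ∈ avoidSet o n u
  · have e1 : avoidSet o n u ∩ pr ⁻¹' {a} = {ω | ∀ i ≤ n, ω i = ex a i} := by
      rw [hcyl]
      refine Set.inter_eq_right.2 ?_
      intro ω hω
      refine ⟨fun i hi hin => ?_, ?_⟩
      · rw [hω i hin]; exact h.1 i hi hin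
      · rw [hω n le_rfl]; exact h.2
    have e2 : avoidSet o n u ∩ {ω | ω (n + 1) = v} ∩ pr ⁻¹' {a} ⊆
        {ω | ∀ i ≤ n + 1, ω i = ex a i} := by
      rintro ω ⟨⟨_, h2⟩, h3⟩ i hi
      rw [hcyl] at h3
      rcases Nat.lt_or_ge i (n + 1) with h4 | h4
      · exact h3 i (by omega)
      · obtain rfl : i = n + 1 := by omega
        rw [hexv]; exact h2
    refine (measure_mono e2).trans ?_
    rw [e1, hμ.2, hμ.2]
    split_ifs
    · rw [Finset.prod_range_succ, hexv, h.2]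
    · simp
  · have : avoidSet o n u ∩ {ω | ω (n + 1) = v} ∩ pr ⁻¹' {a} = ∅ := by
      rw [hcyl]
      refine Set.eq_empty_of_forall_notMem ?_
      rintro ω ⟨⟨h1, _⟩, h3⟩
      refine h ⟨fun i hi hin => ?_, ?_⟩
      · rw [← h3 i hin]; exact h1.1 i hi hin
      · rw [← h3 n le_rfl]; exact h1.2
    rw [this]
    simp

lemma avoid_sum {V E : Type} [Countable V] [MeasurableSpace V]
    [DiscreteMeasurableSpace V]
    (G : DigraphStruct V E) (o : V)
    (μ : Measure (ℕ → V)) (hμ : G.IsWalkLaw o μ) (n : ℕ) (v : V) :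
    μ {ω | (∀ i, 1 ≤ i → i ≤ n → ω i ≠ o) ∧ ω (n + 1) = v} ≤
      ∑' u, μ (avoidSet o n u) * G.stepProb u v := by
  have : {ω : ℕ → V | (∀ i, 1 ≤ i → i ≤ n → ω i ≠ o) ∧ ω (n + 1) = v} ⊆
      ⋃ u, avoidSet o n u ∩ {ω | ω (n + 1) = v} := by
    rintro ω ⟨h1, h2⟩
    exact Set.mem_iUnion.2 ⟨ω n, ⟨h1, rfl⟩, h2⟩
  exact (measure_mono this).trans ((measure_iUnion_le _).trans
    (ENNReal.tsum_le_tsum fun u => avoid_step G o μ hμ n u v))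

lemma flow_bound {V E : Type}
    (G : DigraphStruct V E) (hlf : G.LocallyFinite) (c : ℝ≥0∞) (f : ℕ → V → ℝ≥0∞) (M : ℕ)
    (hf : ∀ u, ∑ n ∈ Finset.range M, c * f n u ≤ (G.outDeg u : ℝ≥0∞)) (v : V) :
    ∑ n ∈ Finset.range M, c * ∑' u, f n u * G.stepProb u v ≤ (G.inDeg v : ℝ≥0∞) := by
  calc ∑ n ∈ Finset.range M, c * ∑' u, f n u * G.stepProb u v
      = ∑' u, (∑ n ∈ Finset.range M, c * f n u) * G.stepProb u v := by
        simp_rw [← ENNReal.tsum_mul_left, Finset.sum_mul]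
        rw [Summable.tsum_finsetSum fun _ _ => ENNReal.summable]
        simp_rw [mul_assoc]
    _ ≤ ∑' u, (G.outDeg u : ℝ≥0∞) * G.stepProb u v :=
        ENNReal.tsum_le_tsum fun u => by gcongr; exact hf u
    _ ≤ ∑' u, nEdges G u v := ENNReal.tsum_le_tsum fun u => by
        unfold DigraphStruct.stepProb nEdges
        exact ENNReal.mul_div_le
    _ ≤ _ := tsum_nEdges_le G hlf v

lemma avoid_bound {V E : Type} [Countable V] [MeasurableSpace V]
    [DiscreteMeasurableSpace V]
    (G : DigraphStruct V E) (hlf : G.LocallyFinite)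
    (hge : ∀ v : V, G.inDeg v ≤ G.outDeg v) (o : V)
    (μ : Measure (ℕ → V)) (hμ : G.IsWalkLaw o μ) (M : ℕ) (v : V) :
    ∑ n ∈ Finset.range M, (G.outDeg o : ℝ≥0∞) * μ (avoidSet o n v) ≤ (G.outDeg v : ℝ≥0∞) := by
  induction M generalizing v with
  | zero => simp
  | succ M ih =>
    rw [Finset.sum_range_succ']
    by_cases hv : v = o
    · subst hv
      have h0 : ∀ n, μ (avoidSet v (n + 1) v) = 0 := by
        intro n
        have : avoidSet v (n + 1) v = ∅ := by
          refine Set.eq_empty_of_forall_notMem ?_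
          rintro ω ⟨h1, h2⟩
          exact h1 (n + 1) (by omega) le_rfl h2
        simp [this]
      have h1 : μ (avoidSet v 0 v) ≤ 1 := hμ.1 ▸ measure_mono (Set.subset_univ _)
      simp only [h0, mul_zero, Finset.sum_const_zero, zero_add]
      calc _ ≤ (G.outDeg v : ℝ≥0∞) * 1 := by gcongr
        _ = _ := mul_one _
    · have h0 : μ (avoidSet o 0 v) = 0 := by
        have : avoidSet o 0 v ⊆ {ω | ∀ i ≤ 0, ω i = (fun _ => v : ℕ → V) i} := by
          rintro ω ⟨_, h2⟩ i hi
          obtain rfl : i = 0 := by omega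
          exact h2
        refine measure_mono_null this ?_
        rw [hμ.2, if_neg hv]
      rw [h0, mul_zero, add_zero]
      refine le_trans ?_ ((flow_bound G hlf _ (fun n u => μ (avoidSet o n u)) M ih v).trans
        (by exact_mod_cast hge v))
      refine Finset.sum_le_sum fun n _ => ?_
      gcongr
      refine le_trans (measure_mono ?_) (avoid_sum G o μ hμ n v)
      rintro ω ⟨h1, h2⟩
      exact ⟨fun i hi hin => h1 i hi (by omega), h2⟩

lemma return_le {V E : Type} [Countable V] [MeasurableSpace V]
    [DiscreteMeasurableSpace V]
    (G : DigraphStruct V E) (hlf : G.LocallyFinite)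
    (hge : ∀ v : V, G.inDeg v ≤ G.outDeg v) (o : V)
    (μ : Measure (ℕ → V)) (hμ : G.IsWalkLaw o μ) :
    (G.outDeg o : ℝ≥0∞) * μ {ω | ∃ n : ℕ, ω (n + 1) = o} ≤ (G.inDeg o : ℝ≥0∞) := by
  classical
  have hsub : {ω : ℕ → V | ∃ n : ℕ, ω (n + 1) = o} ⊆
      ⋃ n : ℕ, {ω | (∀ i, 1 ≤ i → i ≤ n → ω i ≠ o) ∧ ω (n + 1) = o} := by
    intro ω hω
    have hω' : ∃ n : ℕ, ω (n + 1) = o := hω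
    refine Set.mem_iUnion.2 ⟨Nat.find hω', fun i hi hin h => ?_, Nat.find_spec hω'⟩
    obtain ⟨j, rfl⟩ : ∃ j, i = j + 1 := ⟨i - 1, by omega⟩
    exact Nat.find_min hω' (by omega : j < Nat.find hω') h
  calc _ ≤ (G.outDeg o : ℝ≥0∞) *
        ∑' n, ∑' u, μ (avoidSet o n u) * G.stepProb u o := by
        gcongr
        exact (measure_mono hsub).trans ((measure_iUnion_le _).trans
          (ENNReal.tsum_le_tsum fun n => avoid_sum G o μ hμ n o))
    _ ≤ _ := by
        rw [← ENNReal.tsum_mul_left]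
        refine ENNReal.tsum_le_of_sum_range_le fun M => ?_
        exact flow_bound G hlf _ (fun n u => μ (avoidSet o n u)) M
          (avoid_bound G hlf hge o μ hμ M) o

/-- If every vertex of a locally finite digraph has in-degree at most its
out-degree and `o` has at least one outgoing edge, then the return probability of the random
walk started at `o` is at most `indeg(o)/outdeg(o)`; in particular if `outdeg(o) > indeg(o)`
the walk fails to return with positive probability. -/
theorem stmt12 {V E : Type} [Countable V] [Countable E] [MeasurableSpace V]
    [DiscreteMeasurableSpace V]
    (G : DigraphStruct V E) (hlf : G.LocallyFinite)
    (hge : ∀ v : V, G.inDeg v ≤ G.outDeg v) (o : V) (ho : 1 ≤ G.outDeg o)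
    (μ : Measure (ℕ → V)) (hμ : G.IsWalkLaw o μ) :
    μ {ω | ∃ n : ℕ, ω (n + 1) = o} ≤ (G.inDeg o : ℝ≥0∞) / (G.outDeg o : ℝ≥0∞) ∧
    (G.inDeg o < G.outDeg o → μ {ω | ∃ n : ℕ, ω (n + 1) = o} < 1) := by
  have h := return_le G hlf hge o μ hμ
  have h0 : (G.outDeg o : ℝ≥0∞) ≠ 0 := by
    simp only [ne_eq, Nat.cast_eq_zero]; omega
  have h1 : (G.outDeg o : ℝ≥0∞) ≠ ⊤ := ENNReal.natCast_ne_top _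
  have h2 : μ {ω | ∃ n : ℕ, ω (n + 1) = o} ≤ (G.inDeg o : ℝ≥0∞) / (G.outDeg o : ℝ≥0∞) := by
    rw [ENNReal.le_div_iff_mul_le (Or.inl h0) (Or.inl h1), mul_comm]
    exact h
  refine ⟨h2, fun hlt => h2.trans_lt ?_⟩
  rw [ENNReal.div_lt_iff (Or.inl h0) (Or.inl h1), one_mul]
  exact_mod_cast hlt

end DF
end

section
/- Let G be a locally finite digraph in which every vertex has in-degree at most its out-degree, and let o be a vertex with in-degree at least 1. Let G^← denote the digraph obtained from G by reversing the orientation of every edge. Then the return probabilities of the random walks on G^← and on G started at o satisfy P^←_o(return to o) ≥ (out-deg(o)/in-deg(o)) · P_o(return to o). -/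
open MeasureTheory Filter Set
open scoped ENNReal

namespace DF

/-! ### Sequences over a countable state space -/

variable {S : Type}

/-- The set of sequences whose first `n + 1` entries agree with `x`. -/
def hCyl {V : Type} (n : ℕ) (x : ℕ → V) : Set (ℕ → V) := {ω | ∀ i ≤ n, ω i = x i}

theorem hCyl_measurable {V : Type} [MeasurableSpace V] [DiscreteMeasurableSpace V]
    (n : ℕ) (x : ℕ → V) : MeasurableSet (hCyl n x) := by
  have : hCyl n x = ⋂ i : ℕ, ⋂ _ : i ≤ n, (fun ω : ℕ → V => ω i) ⁻¹' {x i} := by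
    ext ω; simp [hCyl]
  rw [this]
  exact MeasurableSet.iInter fun i => MeasurableSet.iInter fun _ =>
    measurable_pi_apply i (MeasurableSet.of_discrete)

/-- The index set of first-return loops. -/
abbrev HIdx {V : Type} (o : V) : Type := Σ n : ℕ, {y : Fin n → V // ∀ i, y i ≠ o}

/-- The loop attached to an index. -/
def hPath {V : Type} (o : V) (p : HIdx o) (i : ℕ) : V :=
  if h : 1 ≤ i ∧ i ≤ p.1 then p.2.1 ⟨i - 1, by omega⟩ else o

theorem hPath_ne {V : Type} (o : V) (p : HIdx o) (i : ℕ) (h1 : 1 ≤ i) (h2 : i ≤ p.1) :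
    hPath o p i ≠ o := by
  unfold hPath; rw [dif_pos ⟨h1, h2⟩]; exact p.2.2 _

theorem hPath_zero {V : Type} (o : V) (p : HIdx o) : hPath o p 0 = o := by
  simp [hPath]

theorem hPath_last {V : Type} (o : V) (p : HIdx o) : hPath o p (p.1 + 1) = o := by
  simp [hPath]

theorem hPath_inj {V : Type} (o : V) (p q : HIdx o) (hn : p.1 = q.1)
    (h : ∀ i, 1 ≤ i → i ≤ p.1 → hPath o p i = hPath o q i) : p = q := by
  obtain ⟨n, y, hy⟩ := p
  obtain ⟨m, z, hz⟩ := q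
  obtain rfl : n = m := hn
  have : y = z := by
    funext i
    have := h (i + 1) (by omega) (by have := i.2; simp only; omega)
    simpa [hPath, Nat.succ_le_iff] using this
  subst this; rfl

theorem h_weight {V E : Type} (G : DigraphStruct V E) (hlf : G.LocallyFinite)
    (hge : ∀ v : V, G.inDeg v ≤ G.outDeg v) (o : V) (ho : 1 ≤ G.inDeg o) (n : ℕ) (x : ℕ → V)
    (h0 : x 0 = o) (h1 : x (n + 1) = o) :
    ((G.outDeg o : ℝ≥0∞) / (G.inDeg o : ℝ≥0∞)) *
      ∏ i ∈ Finset.range (n + 1), G.stepProb (x i) (x (i + 1)) ≤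
    ∏ i ∈ Finset.range (n + 1), G.rev.stepProb (x (n + 1 - i)) (x (n + 1 - (i + 1))) := by
  have hr : ∏ i ∈ Finset.range (n + 1), G.rev.stepProb (x (n + 1 - i)) (x (n + 1 - (i + 1)))
      = ∏ i ∈ Finset.range (n + 1), G.rev.stepProb (x (i + 1)) (x i) := by
    rw [← Finset.prod_range_reflect]
    refine Finset.prod_congr rfl fun i hi => ?_
    have := Finset.mem_range.1 hi
    congr 2 <;> omega
  rw [hr]
  have hs : ∀ u v, G.rev.stepProb v u =
      ({e : E | G.src e = u ∧ G.dst e = v}.ncard : ℝ≥0∞) * (G.inDeg v : ℝ≥0∞)⁻¹ := by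
    intro u v
    have : {e : E | G.rev.src e = v ∧ G.rev.dst e = u} = {e : E | G.src e = u ∧ G.dst e = v} := by
      ext e; exact and_comm
    unfold DigraphStruct.stepProb
    rw [this, div_eq_mul_inv]
    rfl
  simp only [hs]
  simp only [DigraphStruct.stepProb, div_eq_mul_inv]
  rw [Finset.prod_mul_distrib, Finset.prod_mul_distrib]
  rw [Finset.prod_range_succ' (fun i => (G.outDeg (x i) : ℝ≥0∞)⁻¹),
    Finset.prod_range_succ (fun i => (G.inDeg (x (i + 1)) : ℝ≥0∞)⁻¹), h0, h1]
  have hO : (G.outDeg o : ℝ≥0∞) * (G.outDeg o : ℝ≥0∞)⁻¹ = 1 :=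
    ENNReal.mul_inv_cancel (by have := hge o; exact_mod_cast (by omega)) (ENNReal.natCast_ne_top _)
  have hp : ∏ i ∈ Finset.range n, (G.outDeg (x (i + 1)) : ℝ≥0∞)⁻¹ ≤
      ∏ i ∈ Finset.range n, (G.inDeg (x (i + 1)) : ℝ≥0∞)⁻¹ :=
    Finset.prod_le_prod' fun i _ => ENNReal.inv_le_inv.2 (by exact_mod_cast hge _)
  generalize ∏ i ∈ Finset.range (n + 1),
    ({e : E | G.src e = x i ∧ G.dst e = x (i + 1)}.ncard : ℝ≥0∞) = A at *
  generalize ∏ i ∈ Finset.range n, (G.outDeg (x (i + 1)) : ℝ≥0∞)⁻¹ = B at *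
  generalize ∏ i ∈ Finset.range n, (G.inDeg (x (i + 1)) : ℝ≥0∞)⁻¹ = C at *
  calc _ = ((G.outDeg o : ℝ≥0∞) * (G.outDeg o : ℝ≥0∞)⁻¹) * (A * (B * (G.inDeg o : ℝ≥0∞)⁻¹)) := by
        ring
    _ ≤ _ := by rw [hO, one_mul]; gcongr

/-- If every vertex of a locally finite digraph has in-degree at most its
out-degree and `o` has at least one incoming edge, then the return probabilities of the random
walks on the reversed digraph and on `G` started at `o` satisfy
`P⃖ₒ(return) ≥ (outdeg(o)/indeg(o)) ⬝ Pₒ(return)`. -/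
theorem stmt13 {V E : Type} [Countable V] [Countable E] [MeasurableSpace V]
    [DiscreteMeasurableSpace V]
    (G : DigraphStruct V E) (hlf : G.LocallyFinite)
    (hge : ∀ v : V, G.inDeg v ≤ G.outDeg v) (o : V) (ho : 1 ≤ G.inDeg o)
    (μ μ' : Measure (ℕ → V)) (hμ : G.IsWalkLaw o μ) (hμ' : G.rev.IsWalkLaw o μ') :
    ((G.outDeg o : ℝ≥0∞) / (G.inDeg o : ℝ≥0∞)) * μ {ω | ∃ n : ℕ, ω (n + 1) = o} ≤
      μ' {ω | ∃ n : ℕ, ω (n + 1) = o} := by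
  have hcyl : ∀ n x, μ (hCyl n x) = _ := hμ.2
  have hcyl' : ∀ n x, μ' (hCyl n x) = _ := hμ'.2
  have h0 : μ {ω | ω 0 ≠ o} = 0 := by
    have : {ω : ℕ → V | ω 0 ≠ o} ⊆ ⋃ v : {v : V // v ≠ o}, hCyl 0 (fun _ => v.1) := by
      intro ω hω
      refine Set.mem_iUnion.2 ⟨⟨ω 0, hω⟩, ?_⟩
      intro i hi
      obtain rfl : i = 0 := by omega
      rfl
    refine measure_mono_null this (measure_iUnion_null fun v => ?_)
    rw [hcyl, if_neg v.2]
  have hsub : {ω : ℕ → V | ∃ n : ℕ, ω (n + 1) = o} ⊆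
      {ω | ω 0 ≠ o} ∪ ⋃ p : HIdx o, hCyl (p.1 + 1) (hPath o p) := by
    classical
    intro ω hω
    by_cases hz : ω 0 = o
    · right
      have hω' : ∃ n : ℕ, ω (n + 1) = o := hω
      refine Set.mem_iUnion.2 ⟨⟨Nat.find hω', fun i => ω (i + 1),
        fun i => Nat.find_min hω' i.2⟩, ?_⟩
      intro i hi
      simp only at hi
      unfold hPath
      split_ifs with h
      · simp only
        congr 1; omega
      · simp only at h
        rcases Nat.eq_zero_or_pos i with rfl | hi0
        · exact hz
        · obtain rfl : i = Nat.find hω' + 1 := by omega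
          exact Nat.find_spec hω'
    · left; exact hz
  have hub : μ {ω : ℕ → V | ∃ n : ℕ, ω (n + 1) = o} ≤
      ∑' p : HIdx o, μ (hCyl (p.1 + 1) (hPath o p)) := by
    refine (measure_mono hsub).trans ((measure_union_le _ _).trans ?_)
    rw [h0, zero_add]
    exact measure_iUnion_le _
  have hlb : ∑' p : HIdx o, μ' (hCyl (p.1 + 1) (fun i => hPath o p (p.1 + 1 - i))) ≤
      μ' {ω : ℕ → V | ∃ n : ℕ, ω (n + 1) = o} := by
    rw [← measure_iUnion]
    · refine measure_mono ?_
      intro ω hω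
      obtain ⟨p, hp⟩ := Set.mem_iUnion.1 hω
      refine ⟨p.1, ?_⟩
      rw [hp _ le_rfl]
      simp [hPath_zero]
    · intro p q hpq
      refine Set.disjoint_left.2 fun ω hp hq => hpq ?_
      have key : ∀ p q : HIdx o, ω ∈ hCyl (p.1 + 1) (fun i => hPath o p (p.1 + 1 - i)) →
          ω ∈ hCyl (q.1 + 1) (fun i => hPath o q (q.1 + 1 - i)) → ¬ p.1 < q.1 := by
        intro p q hp hq hlt
        have e1 := hp (p.1 + 1) le_rfl
        have e2 := hq (p.1 + 1) (by omega)
        simp only [Nat.sub_self, hPath_zero] at e1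
        exact hPath_ne o q (q.1 + 1 - (p.1 + 1)) (by omega) (by omega) (e2.symm.trans e1)
      have hn : p.1 = q.1 := le_antisymm (not_lt.1 (key q p hq hp)) (not_lt.1 (key p q hp hq))
      refine hPath_inj o p q hn fun i hi1 hi2 => ?_
      have e1 := hp (p.1 + 1 - i) (by omega)
      have e2 := hq (p.1 + 1 - i) (by omega)
      simp only at e1 e2
      rw [show p.1 + 1 - (p.1 + 1 - i) = i by omega] at e1
      rw [show q.1 + 1 - (p.1 + 1 - i) = i by omega] at e2
      exact e1.symm.trans e2
    · intro p
      exact hCyl_measurable _ _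
  refine le_trans (mul_le_mul_right hub _) (le_trans ?_ hlb)
  rw [← ENNReal.tsum_mul_left]
  refine ENNReal.tsum_le_tsum fun p => ?_
  rw [hcyl, hcyl', if_pos (hPath_zero o p), if_pos (by simpa using hPath_last o p)]
  exact h_weight G hlf hge o ho p.1 _ (hPath_zero o p) (hPath_last o p)

end DF
end
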